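/- Let R be a commutative noetherian local ring with residue field k whose Betti numbers β_i^R(k) = dim_k Ext^i_R(k, k) are strictly increasing in i (this holds whenever R is not a hypersurface ring). If A is an acyclic complex of finitely generated free R-modules, then for every j ∈ ℤ and every i ≤ j − rank_R A_j, the residue field k is not isomorphic to a direct summand of Coker ∂_{i+1}; in particular, k is not a direct summand of Coker ∂_{i+1} for any i ≤ −rank_R A_0. -/

import Mathlib

open IsLocalRing CategoryTheory

/-- The length of an `R`-module `M`: the supremum of the lengths of strictly increasing
chains of submodules of `M`.  For a module annihilated by the maximal ideal of a local
ring this coincides with the dimension over the residue field `k`. -/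
noncomputable def moduleLength (R M : Type) [Ring R] [AddCommGroup M] [Module R M] : ℕ∞ :=
  ⨆ p : LTSeries (Submodule R M), (p.length : ℕ∞)

/-- `Ext^n_R(M, N)`, as an object of `ModuleCat R`. -/
noncomputable def extModule (R : Type) [CommRing R] (M N : Type) [AddCommGroup M] [Module R M]
    [AddCommGroup N] [Module R N] (n : ℕ) : ModuleCat R :=
  ((Ext R (ModuleCat R) n).obj (Opposite.op (ModuleCat.of R M))).obj (ModuleCat.of R N)

/-- The `i`-th Betti number `β_i^R(M) = dim_k Ext^i_R(M, k)` of a module `M` over a local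
ring `(R, m, k)`, computed as the length over `R` of `Ext^i_R(M, k)` (an `R`-module
annihilated by `m`, hence a `k`-vector space). -/
noncomputable def bettiNum (R : Type) [CommRing R] [IsLocalRing R] (M : Type) [AddCommGroup M]
    [Module R M] (i : ℕ) : ℕ∞ :=
  moduleLength R (extModule R M (ResidueField R) i).carrier

/-- The `i`-th Bass number `μ^i_R = dim_k Ext^i_R(k, R)` of a local ring `(R, m, k)`. -/
noncomputable def bassNum (R : Type) [CommRing R] [IsLocalRing R] (i : ℕ) : ℕ∞ :=
  moduleLength R (extModule R (ResidueField R) R i).carrier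

/-- The socle `Soc R = (0 :_R m)` of a local ring `(R, m)`. -/
noncomputable def socle (R : Type) [CommRing R] [IsLocalRing R] : Ideal R :=
  Submodule.colon (⊥ : Ideal R) (maximalIdeal R)

/-- The socle dimension `r = dim_k (0 :_R m)` of a local ring `(R, m, k)`. -/
noncomputable def socdim (R : Type) [CommRing R] [IsLocalRing R] : ℕ∞ :=
  moduleLength R (socle R)

/-- The embedding dimension `e = dim_k (m/m²)` of a local ring `(R, m, k)`. -/
noncomputable def embdim (R : Type) [CommRing R] [IsLocalRing R] : ℕ∞ :=
  moduleLength R (CotangentSpace R)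

/-- The residue field `k` is (isomorphic to) a direct summand of the `R`-module `M`,
expressed by a split injection `k → M`. -/
def kSummand (R : Type) [CommRing R] [IsLocalRing R] (M : Type) [AddCommGroup M]
    [Module R M] : Prop :=
  ∃ (f : M →ₗ[R] ResidueField R) (g : ResidueField R →ₗ[R] M), f ∘ₗ g = LinearMap.id

/-- Vanishing of the `i`-th homology of the dual complex `A* = Hom_R(A, R)` of a chain
complex `A` with differentials `d i : A (i+1) → A i` (so that `∂_j = d (j-1)`):
every functional on `A_i` vanishing on the image of `∂_{i+1}` factors through `∂_i`.
(The index `i` is written as `i - 1 + 1` for type-checking reasons.)  Together with the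
automatic inclusion `im ∂*_i ⊆ ker ∂*_{i+1}`, this says exactly `H_i(A*) = 0`. -/
def dualHomologyIsZero (R : Type) [CommRing R] (A : ℤ → Type) [∀ i, AddCommGroup (A i)]
    [∀ i, Module R (A i)] (d : ∀ i : ℤ, A (i + 1) →ₗ[R] A i) (i : ℤ) : Prop :=
  ∀ f : A (i - 1 + 1) →ₗ[R] R, f ∘ₗ d (i - 1 + 1) = 0 →
    ∃ g : A (i - 1) →ₗ[R] R, f = g ∘ₗ d (i - 1)


lemma moduleLength_eq (R M : Type) [Ring R] [AddCommGroup M] [Module R M] :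
    moduleLength R M = Module.length R M := by
  rw [← WithBot.coe_inj, Module.coe_length, Order.krullDim_eq_iSup_length, moduleLength]

/-- The index `i + n`, by recursion on `n`. -/
def idxShift (i : ℤ) : ℕ → ℤ
  | 0 => i
  | n + 1 => idxShift i n + 1

lemma idxShift_eq (i : ℤ) (n : ℕ) : idxShift i n = i + n := by
  induction n with
  | zero => simp [idxShift]
  | succ n ih => simp [idxShift, ih]; ring

section
variable (R : Type) [CommRing R] (A : ℤ → Type) [∀ i, AddCommGroup (A i)] [∀ i, Module R (A i)]
  (d : ∀ i : ℤ, A (i + 1) →ₗ[R] A i)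

/-- The truncation of the complex at `i`. -/
noncomputable def truncCx (hcx : ∀ i, d i ∘ₗ d (i + 1) = 0) (i : ℤ) : ChainComplex (ModuleCat R) ℕ :=
  ChainComplex.of (fun n => ModuleCat.of R (A (idxShift i n)))
    (fun n => ModuleCat.ofHom (d (idxShift i n)))
    (fun n => by
      exact congrArg ModuleCat.ofHom (hcx (idxShift i n)))

lemma truncCx_d (hcx : ∀ i, d i ∘ₗ d (i + 1) = 0) (i : ℤ) (n : ℕ) :
    (truncCx R A d hcx i).d (n + 1) n = ModuleCat.ofHom (d (idxShift i n)) := by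
  exact ChainComplex.of_d (V := ModuleCat R) (α := ℕ)
    (fun n => ModuleCat.of R (A (idxShift i n))) (fun n => ModuleCat.ofHom (d (idxShift i n))) n

lemma truncCx_w (hcx : ∀ i, d i ∘ₗ d (i + 1) = 0) (i : ℤ) :
    (truncCx R A d hcx i).d 1 0 ≫
      (ModuleCat.ofHom (LinearMap.range (d i)).mkQ : ModuleCat.of R (A i) ⟶ _) = 0 := by
  rw [truncCx_d]
  have h : (LinearMap.range (d i)).mkQ ∘ₗ d i = 0 := by
    ext x
    simp
  exact congrArg ModuleCat.ofHom h

/-- The truncation is a resolution of the cokernel. -/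
noncomputable def truncRes (hfree : ∀ i, Module.Free R (A i))
    (hcx : ∀ i, d i ∘ₗ d (i + 1) = 0)
    (hacyclic : ∀ i, LinearMap.range (d (i + 1)) = LinearMap.ker (d i)) (i : ℤ) :
    ProjectiveResolution (ModuleCat.of R (A i ⧸ LinearMap.range (d i))) where
  complex := truncCx R A d hcx i
  projective n := by
    have := hfree (idxShift i n)
    exact (IsProjective.iff_projective (R := R) (A (idxShift i n))).1 inferInstance
  π := (ChainComplex.toSingle₀Equiv _ _).symm
    ⟨ModuleCat.ofHom (LinearMap.range (d i)).mkQ, truncCx_w R A d hcx i⟩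
  quasiIso := ⟨fun n => by
    cases n
    · rw [ChainComplex.quasiIsoAt₀_iff, ShortComplex.quasiIso_iff_of_zeros']
      · refine (ShortComplex.exact_and_epi_g_iff_of_iso
          (S₂ := ShortComplex.mk (ModuleCat.ofHom (d i))
            (ModuleCat.ofHom (LinearMap.range (d i)).mkQ) ?_) ?_).2 ⟨?_, ?_⟩
        · rw [← ModuleCat.ofHom_comp]
          ext x
          simp
        · refine ShortComplex.isoMk (Iso.refl _) (Iso.refl _) (Iso.refl _) ?_ ?_
          · change 𝟙 _ ≫ ModuleCat.ofHom (d i) = (truncCx R A d hcx i).d 1 0 ≫ 𝟙 _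
            rw [truncCx_d]
            rfl
          · change 𝟙 _ ≫ ModuleCat.ofHom (LinearMap.range (d i)).mkQ =
              ((ChainComplex.toSingle₀Equiv (truncCx R A d hcx i) _).symm
                ⟨ModuleCat.ofHom (LinearMap.range (d i)).mkQ, truncCx_w R A d hcx i⟩).f 0 ≫ 𝟙 _
            exact (Category.id_comp _).trans
              ((ChainComplex.toSingle₀Equiv_symm_apply_f_zero
                (C := truncCx R A d hcx i) _ _).symm.trans (Category.comp_id _).symm)
        · rw [ShortComplex.moduleCat_exact_iff]
          intro x hx
          have : x ∈ LinearMap.range (d i) := by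
            rw [← Submodule.Quotient.mk_eq_zero]
            exact hx
          exact this
        · rw [ModuleCat.epi_iff_surjective]
          exact Submodule.mkQ_surjective _
      all_goals rfl
    · rename_i n
      rw [quasiIsoAt_iff_exactAt']
      · rw [HomologicalComplex.exactAt_iff' _ (n + 1 + 1) (n + 1) n (by simp) (by simp)]
        rw [ShortComplex.moduleCat_exact_iff]
        intro x hx
        change (truncCx R A d hcx i).d (n + 1) n x = 0 at hx
        change ∃ y, (truncCx R A d hcx i).d (n + 1 + 1) (n + 1) y = x
        rw [truncCx_d] at hx ⊢
        have : x ∈ LinearMap.ker (d (idxShift i n)) := hx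
        rw [← hacyclic] at this
        exact this
      · apply ChainComplex.exactAt_succ_single_obj⟩

end

lemma length_homology_le (R : Type) [CommRing R] (K : CochainComplex (ModuleCat.{0} R) ℕ) (n : ℕ) :
    Module.length R (K.homology n) ≤ Module.length R (K.X n) := by
  have h1 := (ModuleCat.epi_iff_surjective (K.homologyπ n)).1 inferInstance
  have h2 := (ModuleCat.mono_iff_injective (K.iCycles n)).1 inferInstance
  exact (Module.length_le_of_surjective (K.homologyπ n).hom h1).trans
    (Module.length_le_of_injective (K.iCycles n).hom h2)

lemma length_hom_le (R : Type) [CommRing R] [IsLocalRing R] (M : Type) [AddCommGroup M]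
    [Module R M] [Module.Free R M] [Module.Finite R M] :
    Module.length R (M →ₗ[R] ResidueField R) ≤ Module.finrank R M := by
  have e := (Module.finBasis R M).constr R (M' := ResidueField R)
  rw [← e.length_eq, Module.length_pi]
  have : IsSimpleModule R (ResidueField R) := by
    exact isSimpleModule_iff_quot_maximal.2 ⟨maximalIdeal R, inferInstance, ⟨LinearEquiv.refl R _⟩⟩
  simp [Module.length_eq_one]

lemma betti_zero_ne (R : Type) [CommRing R] [IsLocalRing R] :
    bettiNum R (ResidueField R) 0 ≠ 0 := by
  rw [bettiNum, moduleLength_eq, Ne, Module.length_eq_zero_iff]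
  intro h
  let k := ModuleCat.of R (ResidueField R)
  let P := ProjectiveResolution.of k
  have h1 : Limits.IsZero (extModule R (ResidueField R) (ResidueField R) 0) :=
    @ModuleCat.isZero_of_subsingleton _ _ _ h
  have h2 : Limits.IsZero ((P.complex.linearYonedaObj R k).homology 0) :=
    h1.of_iso (P.isoExt 0 k).symm
  rw [← HomologicalComplex.exactAt_iff_isZero_homology,
    HomologicalComplex.exactAt_iff' _ 0 0 1 (by simp) (by simp),
    ShortComplex.moduleCat_exact_iff] at h2
  obtain ⟨y, hy⟩ := h2 (P.π.f 0) (P.complex_d_comp_π_f_zero)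
  have : P.π.f 0 = 0 := by
    rw [← hy]
    have h0 : (P.complex.linearYonedaObj R k).d 0 0 = 0 :=
      (P.complex.linearYonedaObj R k).shape 0 0 (by simp)
    change (P.complex.linearYonedaObj R k).d 0 0 y = 0
    rw [h0]
    rfl
  have hs := (ModuleCat.epi_iff_surjective (P.π.f 0)).1 inferInstance
  obtain ⟨z, hz⟩ := hs (1 : ResidueField R)
  rw [this] at hz
  exact zero_ne_one (α := ResidueField R) hz

lemma betti_le_of_summand (R : Type) [CommRing R] [IsLocalRing R] (M : Type) [AddCommGroup M]
    [Module R M] (h : kSummand R M) (n : ℕ) :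
    bettiNum R (ResidueField R) n ≤ bettiNum R M n := by
  obtain ⟨f, g, hfg⟩ := h
  rw [bettiNum, bettiNum, moduleLength_eq, moduleLength_eq]
  let F := (Ext R (ModuleCat.{0} R) n).flip.obj (ModuleCat.of R (ResidueField R))
  let a := F.map (ModuleCat.ofHom f).op
  let b := F.map (ModuleCat.ofHom g).op
  have hab : a ≫ b = 𝟙 _ := by
    rw [← F.map_comp, ← op_comp, ← ModuleCat.ofHom_comp, hfg]
    exact F.map_id _
  have : Mono a := mono_of_mono_fac hab
  exact Module.length_le_of_injective a.hom ((ModuleCat.mono_iff_injective a).1 this)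

/-- Let `R` be a commutative noetherian local ring whose residue field `k` has strictly
increasing Betti numbers (as is the case whenever `R` is not a hypersurface).  If `A` is
an acyclic complex of finitely generated free `R`-modules (with differentials
`d i : A (i+1) → A i`, so `Coker ∂_{i+1} = A i ⧸ im (d i)`), then for every `j` and every
`i ≤ j − rank A_j`, the residue field `k` is not a direct summand of `Coker ∂_{i+1}`;
in particular this holds for every `i ≤ −rank A_0`. -/
theorem k_not_summand (R : Type) [CommRing R] [IsNoetherianRing R] [IsLocalRing R]
    (hbetti : ∀ i : ℕ, bettiNum R (ResidueField R) i < bettiNum R (ResidueField R) (i + 1))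
    (A : ℤ → Type) [∀ i, AddCommGroup (A i)] [∀ i, Module R (A i)]
    (hfree : ∀ i, Module.Free R (A i)) (hfin : ∀ i, Module.Finite R (A i))
    (d : ∀ i : ℤ, A (i + 1) →ₗ[R] A i)
    (hcx : ∀ i, d i ∘ₗ d (i + 1) = 0)
    (hacyclic : ∀ i, LinearMap.range (d (i + 1)) = LinearMap.ker (d i)) :
    (∀ j i : ℤ, i ≤ j - (Module.finrank R (A j) : ℤ) →
        ¬ kSummand R (A i ⧸ LinearMap.range (d i))) ∧
    (∀ i : ℤ, i ≤ -(Module.finrank R (A 0) : ℤ) →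
        ¬ kSummand R (A i ⧸ LinearMap.range (d i))) := by
  have key : ∀ j i : ℤ, i ≤ j - (Module.finrank R (A j) : ℤ) →
        ¬ kSummand R (A i ⧸ LinearMap.range (d i)) := by
    intro j i hij hk
    obtain ⟨n, hn⟩ : ∃ n : ℕ, j = i + n := ⟨(j - i).toNat, by omega⟩
    have hj : j = idxShift i n := by rw [idxShift_eq, hn]
    have hr : Module.finrank R (A (idxShift i n)) ≤ n := by rw [← hj]; omega
    have h1 := betti_le_of_summand R _ hk n
    have h2 : bettiNum R (A i ⧸ LinearMap.range (d i)) n ≤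
        Module.finrank R (A (idxShift i n)) := by
      rw [bettiNum, moduleLength_eq]
      let P := truncRes R A d hfree hcx hacyclic i
      let k := ModuleCat.of R (ResidueField R)
      have e := (P.isoExt (R := R) n k).toLinearEquiv
      have := hfree (idxShift i n)
      have := hfin (idxShift i n)
      refine (e.length_eq).trans_le ((length_homology_le R _ n).trans ?_)
      refine le_trans (le_of_eq ?_) (length_hom_le R (A (idxShift i n)))
      exact (ModuleCat.homLinearEquiv (S := R) (M := ModuleCat.of R (A (idxShift i n)))
        (N := k)).length_eq
    have h3 : ∀ m : ℕ, ((m + 1 : ℕ) : ℕ∞) ≤ bettiNum R (ResidueField R) m := by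
      intro m
      induction m with
      | zero => simpa [Order.one_le_iff_ne_zero] using betti_zero_ne R
      | succ m ih =>
        have := Order.add_one_le_of_lt (lt_of_le_of_lt ih (hbetti m))
        exact_mod_cast this
    have h4 := (h3 n).trans (h1.trans h2)
    have h5 : n + 1 ≤ Module.finrank R (A (idxShift i n)) := by exact_mod_cast h4
    omega
  exact ⟨key, fun i hi => key 0 i (by simpa using hi)⟩
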